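/- arXiv:1210.2026 — 2 statements merged into one kernel-verified Lean document; each statement's English description precedes it below -/
import Mathlib

section
/- Let M be a positively t-determined ℕ^n-graded S-module with r^*M ≠ 0. Then depth_S M ≤ depth_S r^*M. -/
open MvPolynomial

noncomputable def mono (K : Type) [Field K] {n : ℕ} (a : Fin n → ℕ) : MvPolynomial (Fin n) K :=
  monomial (Finsupp.equivFunOnFinite.symm a) 1

def rmap {n : ℕ} (t a : Fin n → ℕ) : Fin n → ℕ := fun i => if 0 < a i then t i else 0

def sqrtv {n : ℕ} (a : Fin n → ℕ) : Fin n → ℕ := fun i => if 0 < a i then 1 else 0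

structure MultiGrading (K : Type) [Field K] (n : ℕ) (M : Type) [AddCommGroup M]
    [Module (MvPolynomial (Fin n) K) M] [Module K M]
    [IsScalarTower K (MvPolynomial (Fin n) K) M] where
  g : (Fin n → ℕ) → Submodule K M
  internal : DirectSum.IsInternal g
  compat : ∀ a b : Fin n → ℕ, ∀ m ∈ g a, mono K b • m ∈ g (a + b)

variable {K : Type} [Field K] {n : ℕ}

def PosDetermined {M : Type} [AddCommGroup M] [Module (MvPolynomial (Fin n) K) M] [Module K M]
    [IsScalarTower K (MvPolynomial (Fin n) K) M] (G : MultiGrading K n M) (t : Fin n → ℕ) : Prop :=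
  ∀ (a : Fin n → ℕ) (i : Fin n), t i ≤ a i →
    Set.BijOn (fun m => (X i : MvPolynomial (Fin n) K) • m) (G.g a : Set M) (G.g (a + Pi.single i 1) : Set M)

def IsRStar {M N : Type} [AddCommGroup M] [Module (MvPolynomial (Fin n) K) M] [Module K M]
    [IsScalarTower K (MvPolynomial (Fin n) K) M]
    [AddCommGroup N] [Module (MvPolynomial (Fin n) K) N] [Module K N]
    [IsScalarTower K (MvPolynomial (Fin n) K) N]
    (t : Fin n → ℕ) (G : MultiGrading K n M) (H : MultiGrading K n N) : Prop :=
  ∃ e : (Fin n → ℕ) → (M →ₗ[K] N),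
    (∀ a, Set.InjOn (e a) (G.g (rmap t a))) ∧
    (∀ a, e a '' (G.g (rmap t a)) = (H.g a : Set N)) ∧
    (∀ a b : Fin n → ℕ, ∀ m ∈ G.g (rmap t a),
      e (a + b) (mono K (rmap t (a + b) - rmap t a) • m) = mono K b • e a m)

noncomputable def mdim (R : Type) [CommRing R] (M : Type) [AddCommGroup M] [Module R M] :
    WithBot ℕ∞ :=
  ringKrullDim (R ⧸ (⊤ : Submodule R M).annihilator)

noncomputable def mdepth (K : Type) [Field K] (n : ℕ) (M : Type) [AddCommGroup M] [Module (MvPolynomial (Fin n) K) M] : ℕ :=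
  sSup {k : ℕ | ∃ rs : List (MvPolynomial (Fin n) K), rs.length = k ∧
    (∀ r ∈ rs, r ∈ Ideal.span (Set.range (X : Fin n → MvPolynomial (Fin n) K))) ∧
    RingTheory.Sequence.IsRegular M rs}

noncomputable def IsCM (K : Type) [Field K] (n : ℕ) (M : Type) [AddCommGroup M] [Module (MvPolynomial (Fin n) K) M] : Prop :=
  (mdepth K n M : WithBot ℕ∞) = mdim (MvPolynomial (Fin n) K) M


section Kos
variable {R : Type*} [CommRing R] {n : ℕ}

/-- Koszul sign. -/
def ksgn (R : Type*) [CommRing R] {n : ℕ} (i : Fin n) (F : Finset (Fin n)) : R :=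
  (-1) ^ (F.filter (· < i)).card

lemma ksgn_sq (i : Fin n) (F : Finset (Fin n)) : ksgn R i F * ksgn R i F = 1 := by
  unfold ksgn
  rw [← pow_add, ← two_mul, pow_mul]; simp

lemma ksgn_erase_self (i : Fin n) (F : Finset (Fin n)) : ksgn R i (F.erase i) = ksgn R i F := by
  unfold ksgn
  congr 2
  ext a
  simp only [Finset.mem_filter, Finset.mem_erase]
  constructor
  · rintro ⟨⟨_, h⟩, h'⟩; exact ⟨h, h'⟩
  · rintro ⟨h, h'⟩; exact ⟨⟨ne_of_lt h', h⟩, h'⟩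

lemma ksgn_insert_self (i : Fin n) (F : Finset (Fin n)) : ksgn R i (insert i F) = ksgn R i F := by
  unfold ksgn
  congr 2
  ext a
  simp only [Finset.mem_filter, Finset.mem_insert]
  constructor
  · rintro ⟨h | h, h'⟩
    · exact absurd h (ne_of_lt h')
    · exact ⟨h, h'⟩
  · rintro ⟨h, h'⟩; exact ⟨Or.inr h, h'⟩

lemma ksgn_erase_gt {i j : Fin n} (F : Finset (Fin n)) (hij : i < j) :
    ksgn R i (F.erase j) = ksgn R i F := by
  unfold ksgn
  congr 2
  ext a
  simp only [Finset.mem_filter, Finset.mem_erase]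
  constructor
  · rintro ⟨⟨_, h⟩, h'⟩; exact ⟨h, h'⟩
  · rintro ⟨h, h'⟩; exact ⟨⟨ne_of_lt (h'.trans hij), h⟩, h'⟩

lemma ksgn_erase_lt {i j : Fin n} {F : Finset (Fin n)} (hij : i < j) (hi : i ∈ F) :
    ksgn R j F = - ksgn R j (F.erase i) := by
  unfold ksgn
  have : F.filter (· < j) = insert i ((F.erase i).filter (· < j)) := by
    ext a
    simp only [Finset.mem_filter, Finset.mem_erase, Finset.mem_insert]
    by_cases h : a = i
    · subst h; simp [hi, hij]
    · simp [h]
  rw [this, Finset.card_insert_of_notMem (by simp), pow_succ]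
  ring

lemma ksgn_anti {i j : Fin n} {F : Finset (Fin n)} (hij : i ≠ j) (hi : i ∈ F) (hj : j ∈ F) :
    ksgn R i F * ksgn R j (F.erase i) = - (ksgn R j F * ksgn R i (F.erase j)) := by
  rcases lt_or_gt_of_ne hij with h | h
  · rw [ksgn_erase_gt F h, ksgn_erase_lt h hi]; ring
  · rw [ksgn_erase_gt F h, ksgn_erase_lt h hj]; ring

variable {M : Type*} [AddCommGroup M] [Module R M]

/-- Koszul cochain differential. -/
def kd (y : Fin n → R) : (Finset (Fin n) → M) →ₗ[R] (Finset (Fin n) → M) where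
  toFun f F := ∑ i ∈ F, (ksgn R i F * y i) • f (F.erase i)
  map_add' f g := by
    ext F
    simp [Finset.sum_add_distrib]
  map_smul' r f := by
    ext F
    simp only [Pi.smul_apply, Finset.smul_sum, RingHom.id_apply]
    exact Finset.sum_congr rfl fun i _ => by rw [smul_comm]

lemma kd_apply (y : Fin n → R) (f : Finset (Fin n) → M) (F : Finset (Fin n)) :
    kd y f F = ∑ i ∈ F, (ksgn R i F * y i) • f (F.erase i) := rfl

lemma kd_kd (y : Fin n → R) (f : Finset (Fin n) → M) : kd y (kd y f) = 0 := by
  ext F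
  rw [kd_apply]
  simp only [kd_apply, Finset.smul_sum, Pi.zero_apply]
  rw [Finset.sum_sigma' F (fun i => F.erase i)]
  refine Finset.sum_involution (fun p _ => ⟨p.2, p.1⟩) ?_ ?_ ?_ ?_
  · rintro ⟨i, j⟩ h
    simp only [Finset.mem_sigma, Finset.mem_erase] at h
    simp only [smul_smul]
    rw [Finset.erase_right_comm (a := j), ← add_smul]
    have := ksgn_anti (R := R) (Ne.symm h.2.1) h.1 h.2.2
    have h0 : ksgn R i F * y i * (ksgn R j (F.erase i) * y j) +
        ksgn R j F * y j * (ksgn R i (F.erase j) * y i) = 0 := by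
      linear_combination (y i * y j) * this
    rw [h0, zero_smul]
  · rintro ⟨i, j⟩ h _ he
    simp only [Finset.mem_sigma, Finset.mem_erase] at h
    simp only [Sigma.mk.injEq] at he
    exact h.2.1 he.1
  · rintro ⟨i, j⟩ h
    simp only [Finset.mem_sigma, Finset.mem_erase] at h ⊢
    exact ⟨h.2.2, Ne.symm h.2.1, h.1⟩
  · rintro ⟨i, j⟩ h
    rfl

/-- contraction -/
def ks (j : Fin n) (f : Finset (Fin n) → M) : Finset (Fin n) → M :=
  fun F => if j ∈ F then 0 else ksgn R j F • f (insert j F)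

lemma kd_ks (y : Fin n → R) (j : Fin n) (f : Finset (Fin n) → M) (hf : kd y f = 0) :
    kd y (ks (R := R) j f) = y j • f := by
  ext F
  rw [kd_apply]
  by_cases hj : j ∈ F
  · rw [Finset.sum_eq_single j]
    · simp only [ks, Finset.mem_erase, ne_eq, not_true_eq_false, false_and, if_false, Pi.smul_apply]
      rw [Finset.insert_erase hj, smul_smul, ksgn_erase_self]
      congr 1
      linear_combination (y j) * ksgn_sq (R := R) j F
    · intro i _ hij
      simp [ks, hj, Ne.symm hij]
    · intro h; exact absurd hj h
  · have h1 := congrFun hf (insert j F)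
    rw [kd_apply, Finset.sum_insert hj, Finset.erase_insert hj, ksgn_insert_self] at h1
    simp only [Pi.zero_apply] at h1
    have h2 : ∑ i ∈ F, (ksgn R i F * y i) • ks (R := R) j f (F.erase i) =
      - (ksgn R j F • ∑ i ∈ F, (ksgn R i (insert j F) * y i) • f ((insert j F).erase i)) := by
      rw [Finset.smul_sum, ← Finset.sum_neg_distrib]
      refine Finset.sum_congr rfl fun i hi => ?_
      have hij : i ≠ j := by rintro rfl; exact hj hi
      have hj' : j ∉ F.erase i := fun h => hj (Finset.mem_of_mem_erase h)
      have he : (insert j F).erase i = insert j (F.erase i) := by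
        rw [Finset.erase_insert_of_ne (Ne.symm hij)]
      simp only [ks, hj', if_false]
      rw [he, smul_smul, smul_smul, ← neg_smul]
      congr 1
      have := ksgn_anti (R := R) hij (Finset.mem_insert_of_mem (b := j) hi) (Finset.mem_insert_self j F)
      rw [Finset.erase_insert hj, ksgn_insert_self, he, ksgn_insert_self] at this
      have s1 := ksgn_sq (R := R) i F
      have s2 := ksgn_sq (R := R) i (insert j F)
      linear_combination (ksgn R i F * ksgn R i (insert j F) * y i) * this - (ksgn R i F * ksgn R j (F.erase i) * y i) * s2 + (- ksgn R j F * ksgn R i (insert j F) * y i) * s1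
    rw [h2, ← smul_neg, ← eq_neg_iff_add_eq_zero.mpr h1, smul_smul, Pi.smul_apply]
    congr 1
    linear_combination (y j) * ksgn_sq (R := R) j F


lemma kd_map {M' : Type*} [AddCommGroup M'] [Module R M'] (φ : M →ₗ[R] M') (y : Fin n → R)
    (f : Finset (Fin n) → M) (F : Finset (Fin n)) :
    φ (kd y f F) = kd y (fun G => φ (f G)) F := by
  simp [kd_apply]

/-- Vanishing of Koszul cohomology in degrees `< d`. -/
def Acyc (d : ℕ) (y : Fin n → R) (M : Type*) [AddCommGroup M] [Module R M] : Prop :=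
  ∀ f : Finset (Fin n) → M, (∀ F, d ≤ F.card → f F = 0) → kd y f = 0 → ∃ g, kd y g = f

lemma kd_trunc (y : Fin n → R) (d : ℕ) (f g : Finset (Fin n) → M)
    (hf : ∀ F, d ≤ F.card → f F = 0) (hg : kd y g = f) :
    ∃ g' : Finset (Fin n) → M, (∀ F, d ≤ F.card + 1 → g' F = 0) ∧ kd y g' = f := by
  refine ⟨fun F => if d ≤ F.card + 1 then 0 else g F, fun F h => by simp [h], ?_⟩
  ext F
  rw [kd_apply]
  by_cases h : d ≤ F.card
  · rw [hf F h]
    refine Finset.sum_eq_zero fun i hi => ?_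
    have : d ≤ (F.erase i).card + 1 := by rw [Finset.card_erase_add_one hi]; exact h
    simp [this]
  · rw [← hg, kd_apply]
    refine Finset.sum_congr rfl fun i hi => ?_
    have : ¬ d ≤ (F.erase i).card + 1 := by rw [Finset.card_erase_add_one hi]; exact h
    simp only [this, if_false]

lemma kd_supp (y : Fin n → R) (d : ℕ) (f : Finset (Fin n) → M)
    (hf : ∀ F, d ≤ F.card + 1 → f F = 0) : ∀ F, d ≤ F.card → kd y f F = 0 := by
  intro F hF
  rw [kd_apply]
  refine Finset.sum_eq_zero fun i hi => ?_
  rw [hf _ (by rw [Finset.card_erase_add_one hi]; exact hF), smul_zero]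

lemma span_kills (y : Fin n → R) (f : Finset (Fin n) → M) (hf : kd y f = 0) (r : R)
    (hr : r ∈ Ideal.span (Set.range y)) : ∃ g, kd y g = r • f := by
  induction hr using Submodule.span_induction with
  | mem x h => obtain ⟨j, rfl⟩ := h; exact ⟨_, kd_ks y j f hf⟩
  | zero => exact ⟨0, by simp⟩
  | add a b _ _ ha hb =>
    obtain ⟨g, hg⟩ := ha
    obtain ⟨g', hg'⟩ := hb
    exact ⟨g + g', by rw [map_add, hg, hg', add_smul]⟩
  | smul a b _ hb =>
    obtain ⟨g, hg⟩ := hb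
    exact ⟨a • g, by rw [map_smul, hg, smul_smul, smul_eq_mul]⟩

open Pointwise in
lemma exists_mkq (r : R) (M : Type*) [AddCommGroup M] [Module R M] :
    ∃ q : M →ₗ[R] QuotSMulTop r M, Function.Surjective q ∧ ∀ m, q m = 0 ↔ ∃ k, m = r • k := by
  refine ⟨Submodule.mkQ (r • (⊤ : Submodule R M)), Submodule.mkQ_surjective _, fun m => ?_⟩
  rw [Submodule.mkQ_apply, Submodule.Quotient.mk_eq_zero, Submodule.mem_smul_pointwise_iff_exists]
  simp [eq_comm]

lemma acyc_up_one (y : Fin n → R) (d : ℕ) (r : R) (hr : IsSMulRegular M r)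
    (h : Acyc d y (QuotSMulTop r M)) (f : Finset (Fin n) → M)
    (hf : ∀ F, d + 1 ≤ F.card → f F = 0) (hg : ∃ g, kd y g = r • f) : ∃ g, kd y g = f := by
  obtain ⟨g0, hg0⟩ := hg
  obtain ⟨g, hgs, hg⟩ := kd_trunc y (d + 1) (r • f) g0 (fun F hF => by simp [hf F hF]) hg0
  obtain ⟨q, hqs, hz⟩ := exists_mkq r M
  obtain ⟨h0, hh0⟩ := h (fun F => q (g F)) (fun F hF => by rw [hgs F (by omega), map_zero]) (by
    ext F
    rw [← kd_map, hg]
    exact (hz _).2 ⟨_, rfl⟩)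
  choose l hl using hqs
  have hk : ∀ F, ∃ k, g F - kd y (fun F => l (h0 F)) F = r • k := by
    intro F
    rw [← hz, map_sub, kd_map]
    simp only [hl]
    rw [hh0, sub_self]
  choose k hk using hk
  refine ⟨k, ?_⟩
  have h1 : r • k = g - kd y (fun F => l (h0 F)) := by
    ext F
    simp [hk]
  have h2 : r • kd y k = r • f := by
    rw [← map_smul, h1, map_sub, kd_kd, sub_zero, hg]
  ext F
  exact hr (congrFun h2 F)

lemma acyc_up (y : Fin n → R) (d : ℕ) (r : R) (hr : IsSMulRegular M r)
    (hrad : r ∈ (Ideal.span (Set.range y)).radical)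
    (h : Acyc d y (QuotSMulTop r M)) : Acyc (d + 1) y M := by
  intro f hf hdf
  obtain ⟨N, hN⟩ := hrad
  have h1 := span_kills y f hdf _ hN
  clear hN
  induction N with
  | zero => simpa using h1
  | succ N ih =>
    apply ih
    refine acyc_up_one y d r hr h _ (fun F hF => by simp [hf F hF]) ?_
    obtain ⟨g, hg⟩ := h1
    exact ⟨g, by rw [hg, smul_smul, pow_succ']⟩

open RingTheory.Sequence in
lemma acyc_of_regular (y : Fin n → R) (rs : List R) :
    ∀ (M : Type) [AddCommGroup M] [Module R M], IsWeaklyRegular M rs →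
    (∀ r ∈ rs, r ∈ (Ideal.span (Set.range y)).radical) → Acyc rs.length y M := by
  induction rs with
  | nil =>
    intro M _ _ _ _ f hf _
    exact ⟨0, by rw [map_zero]; ext F; exact (hf F (by simp)).symm⟩
  | cons r rs ih =>
    intro M _ _ h hr
    rw [isWeaklyRegular_cons_iff] at h
    exact acyc_up y _ r h.1 (hr r (by simp)) (ih _ h.2 fun s hs => hr s (by simp [hs]))

lemma acyc_down (y : Fin n → R) (d : ℕ) (r : R) (hr : IsSMulRegular M r)
    (h : Acyc (d + 1) y M) : Acyc d y (QuotSMulTop r M) := by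
  intro f hf hdf
  obtain ⟨q, hqs, hz⟩ := exists_mkq r M
  have hl : ∀ F, ∃ m, q m = f F ∧ (d ≤ F.card → m = 0) := by
    intro F
    by_cases hF : d ≤ F.card
    · exact ⟨0, by rw [hf F hF, map_zero], fun _ => rfl⟩
    · obtain ⟨m, hm⟩ := hqs (f F)
      exact ⟨m, hm, fun h => absurd h hF⟩
  choose l hl hl0 using hl
  have hk : ∀ F, ∃ k, kd y l F = r • k := by
    intro F
    rw [← hz, kd_map]
    simp only [hl]
    rw [hdf]; rfl
  choose k hk using hk
  have hk' : kd y l = r • k := funext hk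
  have hks : ∀ F, d + 1 ≤ F.card → k F = 0 := by
    intro F hF
    apply hr
    change r • k F = r • 0
    rw [← hk, smul_zero]
    exact kd_supp y (d + 1) l (fun F hF => hl0 F (by omega)) F hF
  have hdk : kd y k = 0 := by
    have : r • kd y k = 0 := by rw [← map_smul, ← hk', kd_kd]
    ext F
    apply hr
    simpa using congrFun this F
  obtain ⟨g0, hg0⟩ := h k hks hdk
  obtain ⟨g, hgs, hg⟩ := kd_trunc y (d + 1) k g0 hks hg0
  obtain ⟨p, hp⟩ := h (l - r • g) (fun F hF => by
    simp [hl0 F (by omega), hgs F (by omega)]) (by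
    rw [map_sub, map_smul, hg, hk', sub_self])
  refine ⟨fun F => q (p F), ?_⟩
  ext F
  rw [← kd_map, hp, ← hl F]
  simp only [Pi.sub_apply, Pi.smul_apply, map_sub]
  rw [(hz _).2 ⟨g F, rfl⟩, sub_zero]

lemma exists_regular [IsNoetherianRing R] [Module.Finite R M] (y : Fin n → R) (d : ℕ)
    (h : Acyc (d + 1) y M) : ∃ r ∈ Ideal.span (Set.range y), IsSMulRegular M r := by
  classical
  by_contra hcon
  push Not at hcon
  have hfin := associatedPrimes.finite R M
  have hsub : ((Ideal.span (Set.range y) : Ideal R) : Set R) ⊆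
      ⋃ p ∈ (hfin.toFinset : Set (Ideal R)), ((p : Ideal R) : Set R) := by
    intro r hr
    have h1 := hcon r hr
    rw [Set.Finite.coe_toFinset, biUnion_associatedPrimes_eq_zero_divisors]
    rw [isSMulRegular_iff_right_eq_zero_of_smul] at h1
    push Not at h1
    obtain ⟨m, h1, h2⟩ := h1
    exact ⟨m, h2, h1⟩
  rw [Ideal.subset_union_prime (f := fun p : Ideal R => p) ⊤ ⊤] at hsub
  swap
  · intro p hp _ _
    exact (hfin.mem_toFinset.1 hp).1
  obtain ⟨p, hp, hle⟩ := hsub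
  have hp := hfin.mem_toFinset.1 hp
  obtain ⟨hpp, z, hz⟩ := isAssociatedPrime_iff.1 hp
  have hz0 : z ≠ 0 := by
    rintro rfl
    apply hpp.ne_top
    rw [hz]; ext; simp [Submodule.mem_colon_singleton]
  have hyz : ∀ i, y i • z = 0 := by
    intro i
    have := hle (Ideal.subset_span ⟨i, rfl⟩)
    rw [hz] at this
    simpa [Submodule.mem_colon_singleton] using this
  obtain ⟨g, hg⟩ := h (fun F => if F = ∅ then z else 0) (fun F hF => by
    have : F ≠ ∅ := by rintro rfl; simp at hF
    simp [this]) (by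
    ext F
    rw [kd_apply]
    refine Finset.sum_eq_zero fun i hi => ?_
    split_ifs
    · rw [mul_smul, hyz, smul_zero]
    · simp)
  apply hz0
  have := congrFun hg ∅
  simpa [kd_apply] using this.symm

open RingTheory.Sequence in
lemma regular_of_acyc [IsNoetherianRing R] (y : Fin n → R) (d : ℕ) :
    ∀ (M : Type) [AddCommGroup M] [Module R M] [Module.Finite R M], Acyc d y M →
    ∃ rs : List R, rs.length = d ∧ (∀ r ∈ rs, r ∈ Ideal.span (Set.range y)) ∧
      IsWeaklyRegular M rs := by
  induction d with
  | zero => intro M _ _ _ _; exact ⟨[], rfl, by simp, .nil R M⟩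
  | succ d ih =>
    intro M _ _ _ h
    obtain ⟨r, hr, hreg⟩ := exists_regular y d h
    obtain ⟨rs, h1, h2, h3⟩ := ih (QuotSMulTop r M) (acyc_down y d r hreg h)
    refine ⟨r :: rs, by simp [h1], ?_, (isWeaklyRegular_cons_iff M r rs).2 ⟨hreg, h3⟩⟩
    intro s hs
    rcases List.mem_cons.1 hs with rfl | hs
    · exact hr
    · exact h2 s hs

lemma acyc_bound (y : Fin n → R) (h : Acyc (n + 1) y M) :
    (⊤ : Submodule R M) = Ideal.span (Set.range y) • ⊤ := by
  symm
  rw [eq_top_iff]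
  intro z _
  obtain ⟨g, hg⟩ := h (fun F => if F = Finset.univ then z else 0) (fun F hF => by
    have := Finset.card_le_univ F
    simp at this; omega) (by
    ext F
    rw [kd_apply]
    refine Finset.sum_eq_zero fun i hi => ?_
    have : F.erase i ≠ Finset.univ := by
      intro h
      have : i ∈ F.erase i := by rw [h]; simp
      simp at this
    simp [this])
  have := congrFun hg Finset.univ
  simp only [if_true] at this
  rw [← this, kd_apply]
  refine Submodule.sum_mem _ fun i _ => Submodule.smul_mem_smul ?_ trivial
  exact Ideal.mul_mem_left _ _ (Ideal.subset_span ⟨i, rfl⟩)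

end Kos

section Grad

lemma ksgn_smul_map {S : Type*} [CommRing S] {A B : Type*} [AddCommGroup A] [AddCommGroup B]
    [Module S A] [Module S B] (φ : A →+ B) (i : Fin n) (F : Finset (Fin n)) (m : A) :
    φ (ksgn S i F • m) = ksgn S i F • φ m := by
  unfold ksgn
  rcases neg_one_pow_eq_or S (F.filter (· < i)).card with h | h <;> simp [h]

lemma X_eq_mono (i : Fin n) : (X i : MvPolynomial (Fin n) K) = mono K (Pi.single i 1) := by
  unfold mono X
  congr 1
  ext j
  simp [Finsupp.single_apply, Pi.single_apply, eq_comm]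

lemma mono_add (a b : Fin n → ℕ) : mono K (a + b) = mono K a * mono K b := by
  unfold mono
  rw [monomial_mul, mul_one]
  have : Finsupp.equivFunOnFinite.symm (a + b) =
    Finsupp.equivFunOnFinite.symm a + Finsupp.equivFunOnFinite.symm b := by ext; simp
  rw [this]

lemma mono_zero : mono K (0 : Fin n → ℕ) = 1 := by
  unfold mono
  have : Finsupp.equivFunOnFinite.symm (0 : Fin n → ℕ) = 0 := by ext; simp
  rw [this]; rfl

lemma X_pow_eq_mono (i : Fin n) (k : ℕ) :
    (X i ^ k : MvPolynomial (Fin n) K) = mono K (Pi.single i k) := by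
  induction k with
  | zero => rw [Pi.single_zero, mono_zero, pow_zero]
  | succ k ih => rw [Pi.single_add, mono_add, pow_succ, ih, X_eq_mono]

variable {M : Type} [AddCommGroup M] [Module (MvPolynomial (Fin n) K) M]
    [Module K M] [IsScalarTower K (MvPolynomial (Fin n) K) M]

lemma MultiGrading.bij (G : MultiGrading K n M) :
    Function.Bijective (DirectSum.coeLinearMap G.g) := G.internal

/-- homogeneous component -/
noncomputable def MultiGrading.proj (G : MultiGrading K n M) (a : Fin n → ℕ) : M →ₗ[K] M :=
  (G.g a).subtype ∘ₗ DirectSum.component K _ _ a ∘ₗ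
    (LinearEquiv.ofBijective (DirectSum.coeLinearMap G.g) G.bij).symm.toLinearMap

namespace MultiGrading
variable (G : MultiGrading K n M)

lemma proj_mem (a : Fin n → ℕ) (m : M) : G.proj a m ∈ G.g a := by
  simp [proj]

lemma symm_of_mem {a : Fin n → ℕ} {m : M} (h : m ∈ G.g a) :
    (LinearEquiv.ofBijective (DirectSum.coeLinearMap G.g) G.bij).symm m =
      DirectSum.lof K _ (fun a => G.g a) a ⟨m, h⟩ := by
  rw [LinearEquiv.symm_apply_eq]
  simp

lemma proj_of_mem {a : Fin n → ℕ} {m : M} (h : m ∈ G.g a) : G.proj a m = m := by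
  simp only [proj, LinearMap.comp_apply, LinearEquiv.coe_coe, G.symm_of_mem h]
  simp [DirectSum.component.lof_self]

lemma proj_of_mem_ne {a b : Fin n → ℕ} {m : M} (h : m ∈ G.g a) (hab : a ≠ b) :
    G.proj b m = 0 := by
  simp only [proj, LinearMap.comp_apply, LinearEquiv.coe_coe, G.symm_of_mem h]
  simp [DirectSum.component.of, hab]

lemma hind {P : M → Prop} (h0 : P 0) (h1 : ∀ a, ∀ m ∈ G.g a, P m)
    (h2 : ∀ x y, P x → P y → P (x + y)) (m : M) : P m := by
  have : m ∈ iSup G.g := by rw [G.internal.submodule_iSup_eq_top]; trivial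
  exact Submodule.iSup_induction G.g (motive := P) this h1 h0 h2

lemma proj_ext {m m' : M} (h : ∀ a, G.proj a m = G.proj a m') : m = m' := by
  apply (LinearEquiv.ofBijective (DirectSum.coeLinearMap G.g) G.bij).symm.injective
  refine DFinsupp.ext fun a => Subtype.ext ?_
  exact h a

lemma proj_finite (m : M) : {a | G.proj a m ≠ 0}.Finite := by
  refine G.hind (P := fun m => {a | G.proj a m ≠ 0}.Finite) (by simp) ?_ ?_ m
  · intro a m hm
    refine (Set.finite_singleton a).subset ?_
    intro b hb
    by_contra hne
    exact hb (G.proj_of_mem_ne hm (fun h => hne (by simp [h])))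
  · intro x y hx hy
    refine (hx.union hy).subset ?_
    intro b hb
    by_contra hne
    simp only [Set.mem_union, Set.mem_ofPred_eq, not_or, not_not] at hne
    exact hb (by rw [map_add, hne.1, hne.2, add_zero])

lemma proj_mono_smul (a b : Fin n → ℕ) (m : M) :
    G.proj (a + b) (mono K b • m) = mono K b • G.proj a m := by
  refine G.hind (P := fun m => G.proj (a + b) (mono K b • m) = mono K b • G.proj a m) (by simp) ?_ ?_ m
  · intro c m hm
    by_cases h : c = a
    · subst h
      rw [G.proj_of_mem hm, G.proj_of_mem (G.compat _ _ _ hm)]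
    · rw [G.proj_of_mem_ne hm h, G.proj_of_mem_ne (G.compat _ _ _ hm), smul_zero]
      simpa using h
  · intro x y hx hy
    simp only [smul_add, map_add, hx, hy]

lemma proj_mono_smul_zero (a b : Fin n → ℕ) (h : ¬ b ≤ a) (m : M) :
    G.proj a (mono K b • m) = 0 := by
  refine G.hind (P := fun m => G.proj a (mono K b • m) = 0) (by simp) ?_ ?_ m
  · intro c m hm
    refine G.proj_of_mem_ne (G.compat _ _ _ hm) ?_
    rintro rfl
    exact h (fun i => by simp)
  · intro x y hx hy
    simp only [smul_add, map_add, hx, hy, add_zero]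

lemma smul_top_ne (G : MultiGrading K n M) [Nontrivial M] :
    (⊤ : Submodule (MvPolynomial (Fin n) K) M) ≠
      Ideal.span (Set.range (X : Fin n → MvPolynomial (Fin n) K)) • ⊤ := by
  intro htop
  have hne : {b | ∃ m, G.proj b m ≠ 0}.Nonempty := by
    obtain ⟨z, hz⟩ := exists_ne (0 : M)
    by_contra h
    apply hz
    apply G.proj_ext
    intro a
    rw [map_zero]
    by_contra h'
    exact h ⟨a, z, h'⟩
  obtain ⟨b, ⟨z, hz⟩, hmin⟩ := WellFounded.has_min (wellFounded_lt (α := Fin n → ℕ)) _ hne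
  have key : ∀ r ∈ Ideal.span (Set.range (X : Fin n → MvPolynomial (Fin n) K)), ∀ m : M,
      G.proj b (r • m) = 0 := by
    intro r hr
    induction hr using Submodule.span_induction with
    | mem x h =>
      obtain ⟨i, rfl⟩ := h
      intro m
      rw [X_eq_mono]
      by_cases hb : Pi.single i 1 ≤ b
      · obtain ⟨c, rfl⟩ := exists_add_of_le hb
        rw [add_comm, G.proj_mono_smul]
        by_contra h
        refine hmin c ⟨m, fun h' => h (by rw [h', smul_zero])⟩ ?_
        refine lt_of_le_of_ne (fun j => by simp) ?_
        intro h
        have := congrFun h i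
        simp at this
      · exact G.proj_mono_smul_zero _ _ hb _
    | zero => simp
    | add x y _ _ hx hy => intro m; rw [add_smul, map_add, hx, hy, add_zero]
    | smul a x _ hx => intro m; rw [smul_eq_mul, mul_comm, mul_smul, hx]
  apply hz
  have hzt : z ∈ Ideal.span (Set.range (X : Fin n → MvPolynomial (Fin n) K)) •
      (⊤ : Submodule (MvPolynomial (Fin n) K) M) := by rw [← htop]; trivial
  refine Submodule.smul_induction_on hzt (fun r hr m _ => key r hr m) ?_
  intro x y hx hy
  rw [map_add, hx, hy, add_zero]

open Pointwise in
lemma fin_span [Module.Finite (MvPolynomial (Fin n) K) M] (a : Fin n → ℕ) :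
    ∃ B : Set M, B.Finite ∧ G.g a = Submodule.span K B := by
  obtain ⟨s, hs⟩ := Module.Finite.fg_top (R := MvPolynomial (Fin n) K) (M := M)
  have h1 : Submodule.span K (Set.range (mono K (n := n))) = ⊤ := by
    rw [← (basisMonomials (Fin n) K).span_eq]
    congr 1
    ext p
    simp only [Set.mem_range, coe_basisMonomials, mono]
    constructor
    · rintro ⟨b, rfl⟩; exact ⟨_, rfl⟩
    · rintro ⟨b, rfl⟩; exact ⟨b, by simp⟩
  have h2 := Submodule.span_smul_of_span_eq_top h1 (s : Set M)
  rw [hs] at h2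
  refine ⟨G.proj a '' (Set.range (mono K (n := n)) • (s : Set M)), ?_, ?_⟩
  · have hfin : (insert 0 (Set.image2 (fun b m => G.proj a (mono K b • m)) (Set.Iic a) (s : Set M))).Finite :=
      ((Set.finite_Iic a).image2 _ s.finite_toSet).insert 0
    refine hfin.subset ?_
    rintro _ ⟨_, ⟨_, ⟨b, rfl⟩, m, hm, rfl⟩, rfl⟩
    by_cases hb : b ≤ a
    · exact Or.inr ⟨b, hb, m, hm, rfl⟩
    · exact Or.inl (G.proj_mono_smul_zero _ _ hb _)
  · rw [← Submodule.map_span, h2]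
    ext m
    constructor
    · intro h
      exact ⟨m, trivial, G.proj_of_mem h⟩
    · rintro ⟨m, _, rfl⟩
      exact G.proj_mem _ _

end MultiGrading

variable {N : Type} [AddCommGroup N] [Module (MvPolynomial (Fin n) K) N]
    [Module K N] [IsScalarTower K (MvPolynomial (Fin n) K) N]

lemma rstar_bij {t : Fin n → ℕ} {G : MultiGrading K n M} {H : MultiGrading K n N}
    (hN : IsRStar t G H) (a : Fin n → ℕ) (b : Fin n → ℕ) (hb : ∀ i, 0 < b i → 0 < a i) :
    Set.BijOn (fun m => mono K b • m) (H.g a : Set N) (H.g (a + b) : Set N) := by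
  obtain ⟨e, he1, he2, he3⟩ := hN
  have hr : rmap t (a + b) = rmap t a := by
    ext i
    simp only [rmap, Pi.add_apply]
    have := hb i
    congr 1
    simp only [eq_iff_iff]
    omega
  have he3' : ∀ m ∈ G.g (rmap t a), e (a + b) m = mono K b • e a m := by
    intro m hm
    rw [← he3 a b m hm, hr, tsub_self, mono_zero, one_smul]
  refine ⟨fun m hm => H.compat _ _ _ hm, ?_, ?_⟩
  · intro x hx y hy hxy
    rw [← he2] at hx hy
    obtain ⟨x, hx, rfl⟩ := hx
    obtain ⟨y, hy, rfl⟩ := hy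
    simp only at hxy
    rw [← he3' x hx, ← he3' y hy] at hxy
    rw [he1 (a + b) (by rw [hr]; exact hx) (by rw [hr]; exact hy) hxy]
  · intro x hx
    rw [← he2, hr] at hx
    obtain ⟨x, hx, rfl⟩ := hx
    refine ⟨e a x, ?_, (he3' x hx).symm⟩
    rw [← he2]; exact ⟨x, hx, rfl⟩

lemma rstar_finite {t : Fin n → ℕ} {G : MultiGrading K n M} {H : MultiGrading K n N}
    [Module.Finite (MvPolynomial (Fin n) K) M]
    (hN : IsRStar t G H) : Module.Finite (MvPolynomial (Fin n) K) N := by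
  have hN' := hN
  obtain ⟨e, he1, he2, he3⟩ := hN'
  choose B hB1 hB2 using fun a => G.fin_span a
  let ind : Finset (Fin n) → (Fin n → ℕ) := fun F i => if i ∈ F then 1 else 0
  let T : Set N := ⋃ F : Finset (Fin n), e (ind F) '' B (rmap t (ind F))
  have hT : T.Finite := Set.finite_iUnion fun F => (hB1 _).image _
  refine ⟨Submodule.fg_def.2 ⟨T, hT, ?_⟩⟩
  rw [eq_top_iff]
  intro m _
  refine H.hind (P := fun m => m ∈ Submodule.span (MvPolynomial (Fin n) K) T)
    (Submodule.zero_mem _) ?_ (fun x y => Submodule.add_mem _) m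
  intro a m hm
  have hsq : ∀ F, ∀ m ∈ H.g (ind F), m ∈ Submodule.span (MvPolynomial (Fin n) K) T := by
    intro F m hm
    have hm' : m ∈ (H.g (ind F) : Set N) := hm
    rw [← he2] at hm'
    obtain ⟨x, hx, rfl⟩ := hm'
    rw [hB2] at hx
    have h1 : e (ind F) x ∈ Submodule.span K T := by
      have := Submodule.mem_map_of_mem (f := e (ind F)) hx
      rw [Submodule.map_span] at this
      exact Submodule.span_mono (Set.subset_iUnion (fun F => e (ind F) '' B (rmap t (ind F))) F) this
    exact Submodule.span_le_restrictScalars K (MvPolynomial (Fin n) K) T h1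
  have hdec : a = ind (Finset.univ.filter (fun i => 0 < a i)) + fun i => a i - 1 := by
    ext i
    simp only [ind, Finset.mem_filter, Finset.mem_univ, true_and, Pi.add_apply]
    split_ifs <;> omega
  have hb := rstar_bij hN (ind (Finset.univ.filter (fun i => 0 < a i))) (fun i => a i - 1) (by
    intro i hi
    simp only [ind, Finset.mem_filter, Finset.mem_univ, true_and]
    split_ifs <;> omega)
  rw [← hdec] at hb
  obtain ⟨x, hx, rfl⟩ := hb.2.2 hm
  exact Submodule.smul_mem _ _ (hsq _ _ hx)


/-- degree of the `F`-component of a Koszul cochain of (shifted) degree `c` -/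
def kdeg (c : Fin n → ℕ) (F : Finset (Fin n)) : Fin n → ℕ := fun i => if i ∈ F then c i else c i - 1

/-- whether the degree is nonnegative -/
def kgood (c : Fin n → ℕ) (F : Finset (Fin n)) : Prop := ∀ i, i ∉ F → 1 ≤ c i

lemma kdeg_erase {c : Fin n → ℕ} {F : Finset (Fin n)} {i : Fin n} (hi : i ∈ F) (hc : 1 ≤ c i) :
    kdeg c F = kdeg c (F.erase i) + Pi.single i 1 := by
  ext j
  by_cases h : j = i
  · subst h; simp [kdeg, hi]; omega
  · simp [kdeg, h]

lemma kgood_erase {c : Fin n → ℕ} {F : Finset (Fin n)} {i : Fin n} (hc : 1 ≤ c i) :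
    kgood c (F.erase i) ↔ kgood c F := by
  constructor
  · intro h j hj
    exact h j (fun h' => hj (Finset.mem_of_mem_erase h'))
  · intro h j hj
    by_cases hji : j = i
    · subst hji; exact hc
    · exact h j (fun h' => hj (Finset.mem_erase.2 ⟨hji, h'⟩))

lemma not_kgood_erase {c : Fin n → ℕ} {F : Finset (Fin n)} {i : Fin n} (hc : ¬ 1 ≤ c i) :
    ¬ kgood c (F.erase i) := fun h => hc (h i (by simp))

open Classical in
/-- component of degree `c` of a Koszul cochain -/
noncomputable def kcomp (H : MultiGrading K n N) (c : Fin n → ℕ) (f : Finset (Fin n) → N) :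
    Finset (Fin n) → N :=
  fun F => if kgood c F then H.proj (kdeg c F) (f F) else 0

lemma kcomp_mem (H : MultiGrading K n N) (c : Fin n → ℕ) (f : Finset (Fin n) → N)
    (F : Finset (Fin n)) : kcomp H c f F ∈ H.g (kdeg c F) := by
  unfold kcomp
  split_ifs
  · exact H.proj_mem _ _
  · exact Submodule.zero_mem _

lemma kd_kcomp (H : MultiGrading K n N) (c : Fin n → ℕ) (f : Finset (Fin n) → N) :
    kd (X : Fin n → MvPolynomial (Fin n) K) (kcomp H c f) = kcomp H c (kd (X : Fin n → MvPolynomial (Fin n) K) f) := by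
  ext F
  rw [kd_apply]
  by_cases hF : kgood c F
  · simp only [kcomp, hF, if_true]
    rw [kd_apply, map_sum]
    refine Finset.sum_congr rfl fun i hi => ?_
    rw [mul_smul, mul_smul]
    have := ksgn_smul_map (S := MvPolynomial (Fin n) K) (H.proj (kdeg c F)).toAddMonoidHom i F
      ((X i : MvPolynomial (Fin n) K) • f (F.erase i))
    simp only [LinearMap.toAddMonoidHom_coe] at this
    rw [this]
    congr 1
    by_cases hc : 1 ≤ c i
    · rw [if_pos ((kgood_erase hc).2 hF), kdeg_erase hi hc, X_eq_mono, H.proj_mono_smul]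
    · rw [if_neg (not_kgood_erase hc), X_eq_mono, H.proj_mono_smul_zero, smul_zero]
      intro h
      have := h i
      simp [kdeg, hi] at this
      omega
  · simp only [kcomp, hF, if_false]
    refine Finset.sum_eq_zero fun i hi => ?_
    rw [if_neg, smul_zero]
    by_cases hc : 1 ≤ c i
    · rwa [kgood_erase hc]
    · exact not_kgood_erase hc

lemma sum_kcomp (H : MultiGrading K n N) (f : Finset (Fin n) → N) :
    ∃ T : Finset (Fin n → ℕ), f = ∑ c ∈ T, kcomp H c f := by
  classical
  let sh : Finset (Fin n) → (Fin n → ℕ) → (Fin n → ℕ) := fun F b i => if i ∈ F then b i else b i + 1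
  refine ⟨Finset.univ.biUnion fun F => (H.proj_finite (f F)).toFinset.image (sh F), ?_⟩
  ext F
  rw [Finset.sum_apply]
  apply H.proj_ext
  intro b
  rw [map_sum]
  have hdeg : kdeg (sh F b) F = b := by
    ext i; simp only [kdeg, sh]; split_ifs <;> rfl
  have hgood : kgood (sh F b) F := by
    intro i hi; simp [sh, hi]
  rw [Finset.sum_eq_single (sh F b)]
  · simp only [kcomp, hgood, if_true, hdeg]
    exact (H.proj_of_mem (H.proj_mem _ _)).symm
  · intro c _ hc
    by_cases hF : kgood c F
    · refine H.proj_of_mem_ne (kcomp_mem H c f F) ?_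
      rintro rfl
      apply hc
      ext i
      simp only [sh, kdeg]
      split_ifs with h
      · rfl
      · have := hF i h; omega
    · simp [kcomp, hF]
  · intro h
    simp only [kcomp, hgood, if_true, hdeg]
    rw [H.proj_of_mem (H.proj_mem _ _)]
    by_contra hne
    apply h
    rw [Finset.mem_biUnion]
    exact ⟨F, Finset.mem_univ _, Finset.mem_image_of_mem _ ((H.proj_finite _).mem_toFinset.2 hne)⟩

lemma acyc_case1 {t : Fin n → ℕ} {G : MultiGrading K n M} {H : MultiGrading K n N}
    (hN : IsRStar t G H) (c : Fin n → ℕ) (i : Fin n) (hi : 2 ≤ c i) (f : Finset (Fin n) → N)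
    (hf : ∀ F, f F ∈ H.g (kdeg c F)) (hf0 : ∀ F, ¬ kgood c F → f F = 0)
    (hdf : kd (X : Fin n → MvPolynomial (Fin n) K) f = 0) :
    ∃ g, kd (X : Fin n → MvPolynomial (Fin n) K) g = f := by
  have hbij : ∀ F, Set.BijOn (fun m => (X i : MvPolynomial (Fin n) K) • m)
      (H.g (kdeg c F) : Set N) (H.g (kdeg c F + Pi.single i 1) : Set N) := by
    intro F
    rw [X_eq_mono]
    refine rstar_bij hN _ _ ?_
    intro j hj
    by_cases h : j = i
    · subst h; simp only [kdeg]; split_ifs <;> omega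
    · simp [h] at hj
  have hex : ∀ F, ∃ g ∈ H.g (kdeg c F), (¬ kgood c F → g = 0) ∧
      (X i : MvPolynomial (Fin n) K) • g = ks (R := MvPolynomial (Fin n) K) i f F := by
    intro F
    by_cases hF : kgood c F
    · by_cases hiF : i ∈ F
      · exact ⟨0, Submodule.zero_mem _, fun _ => rfl, by simp [ks, hiF]⟩
      · have h1 : ks (R := MvPolynomial (Fin n) K) i f F ∈ H.g (kdeg c F + Pi.single i 1) := by
          simp only [ks, hiF, if_false]
          have h2 := hf (insert i F)
          rw [kdeg_erase (Finset.mem_insert_self i F) (by omega), Finset.erase_insert hiF] at h2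
          unfold ksgn
          rcases neg_one_pow_eq_or (MvPolynomial (Fin n) K) (F.filter (· < i)).card with h | h
          · rw [h, one_smul]; exact h2
          · rw [h, neg_smul, one_smul]; exact Submodule.neg_mem _ h2
        obtain ⟨g, hg, hg'⟩ := (hbij F).2.2 h1
        exact ⟨g, hg, fun h => absurd hF h, hg'⟩
    · refine ⟨0, Submodule.zero_mem _, fun _ => rfl, ?_⟩
      simp only [ks, smul_zero]
      split_ifs with hiF
      · rfl
      · rw [hf0, smul_zero]
        rw [← kgood_erase (i := i) (by omega), Finset.erase_insert hiF]
        exact hF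
  choose g hg hg0 hgX using hex
  refine ⟨g, ?_⟩
  have hmem : ∀ F, kd (X : Fin n → MvPolynomial (Fin n) K) g F ∈ H.g (kdeg c F) := by
    intro F
    rw [kd_apply]
    refine Submodule.sum_mem _ fun j hj => ?_
    rw [mul_smul]
    have h2 : (X j : MvPolynomial (Fin n) K) • g (F.erase j) ∈ H.g (kdeg c F) := by
      by_cases hc : 1 ≤ c j
      · rw [kdeg_erase hj hc, X_eq_mono]
        exact H.compat _ _ _ (hg _)
      · rw [hg0 _ (not_kgood_erase hc), smul_zero]; exact Submodule.zero_mem _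
    unfold ksgn
    rcases neg_one_pow_eq_or (MvPolynomial (Fin n) K) (F.filter (· < j)).card with h | h
    · rw [h, one_smul]; exact h2
    · rw [h, neg_smul, one_smul]; exact Submodule.neg_mem _ h2
  have heq : (X i : MvPolynomial (Fin n) K) • kd (X : Fin n → MvPolynomial (Fin n) K) g =
      (X i : MvPolynomial (Fin n) K) • f := by
    rw [← kd_ks X i f hdf, ← map_smul]
    congr 1
    ext F
    exact hgX F
  ext F
  exact (hbij F).2.1 (hmem F) (hf F) (congrFun heq F)

lemma acyc_case2 {t : Fin n → ℕ} (ht : ∀ i, 1 ≤ t i)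
    {G : MultiGrading K n M} {H : MultiGrading K n N}
    (hN : IsRStar t G H) (d : ℕ)
    (hM : Acyc d (fun i => (X i ^ t i : MvPolynomial (Fin n) K)) M)
    (c : Fin n → ℕ) (hc1 : ∀ i, c i ≤ 1) (f : Finset (Fin n) → N)
    (hfs : ∀ F, d ≤ F.card → f F = 0)
    (hf : ∀ F, f F ∈ H.g (kdeg c F)) (hf0 : ∀ F, ¬ kgood c F → f F = 0)
    (hdf : kd (X : Fin n → MvPolynomial (Fin n) K) f = 0) :
    ∃ g, kd (X : Fin n → MvPolynomial (Fin n) K) g = f := by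
  classical
  obtain ⟨e, he1, he2, he3⟩ := hN
  set y : Fin n → MvPolynomial (Fin n) K := fun i => X i ^ t i with hy
  have hrm : ∀ F i, i ∈ F → 1 ≤ c i →
      rmap t (kdeg c F) = rmap t (kdeg c (F.erase i)) + Pi.single i (t i) := by
    intro F i hi hc
    ext j
    by_cases h : j = i
    · subst h
      have h0 : kdeg c F j = 1 := by simp only [kdeg, hi, if_true]; have := hc1 j; omega
      have h1 : kdeg c (F.erase j) j = 0 := by simp [kdeg]; have := hc1 j; omega
      simp [rmap, h0, h1]
    · have h1 : kdeg c (F.erase i) j = kdeg c F j := by simp [kdeg, h]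
      simp [rmap, h1, h]
  have hrm0 : ∀ F i, i ∈ F → ¬ 1 ≤ c i → rmap t (kdeg c F) i = 0 := by
    intro F i hi hc
    have : c i = 0 := by omega
    simp [rmap, kdeg, hi, this]
  have key : ∀ h : Finset (Fin n) → M, (∀ F, h F ∈ G.g (rmap t (kdeg c F))) →
      (∀ F, ¬ kgood c F → h F = 0) → ∀ F,
      kd (X : Fin n → MvPolynomial (Fin n) K) (fun F => e (kdeg c F) (h F)) F = e (kdeg c F) (kd y h F) ∧
      kd y h F ∈ G.g (rmap t (kdeg c F)) := by
    intro h hh hh0 F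
    constructor
    · rw [kd_apply, kd_apply, map_sum]
      refine Finset.sum_congr rfl fun i hi => ?_
      rw [mul_smul, mul_smul]
      have := ksgn_smul_map (S := MvPolynomial (Fin n) K) (e (kdeg c F)).toAddMonoidHom i F
        (y i • h (F.erase i))
      simp only [LinearMap.toAddMonoidHom_coe] at this
      rw [this]
      congr 1
      by_cases hc : 1 ≤ c i
      · have h3 := he3 (kdeg c (F.erase i)) (Pi.single i 1) (h (F.erase i)) (hh _)
        rw [← kdeg_erase hi hc, hrm F i hi hc, add_tsub_cancel_left, ← X_eq_mono,
          ← X_pow_eq_mono] at h3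
        exact h3.symm
      · rw [hh0 _ (not_kgood_erase hc)]; simp
    · rw [kd_apply]
      refine Submodule.sum_mem _ fun i hi => ?_
      rw [mul_smul]
      have h2 : y i • h (F.erase i) ∈ G.g (rmap t (kdeg c F)) := by
        by_cases hc : 1 ≤ c i
        · rw [hrm F i hi hc, hy]
          simp only
          rw [X_pow_eq_mono]
          exact G.compat _ _ _ (hh _)
        · rw [hh0 _ (not_kgood_erase hc), smul_zero]; exact Submodule.zero_mem _
      unfold ksgn
      rcases neg_one_pow_eq_or (MvPolynomial (Fin n) K) (F.filter (· < i)).card with h | h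
      · rw [h, one_smul]; exact h2
      · rw [h, neg_smul, one_smul]; exact Submodule.neg_mem _ h2
  have key0 : ∀ h : Finset (Fin n) → M, (∀ F, ¬ kgood c F → h F = 0) →
      ∀ F, ¬ kgood c F → kd y h F = 0 := by
    intro h hh0 F hF
    rw [kd_apply]
    refine Finset.sum_eq_zero fun i hi => ?_
    rw [hh0, smul_zero]
    by_cases hc : 1 ≤ c i
    · rwa [kgood_erase hc]
    · exact not_kgood_erase hc
  have hex : ∀ F, ∃ m ∈ G.g (rmap t (kdeg c F)), e (kdeg c F) m = f F := by
    intro F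
    have : f F ∈ (H.g (kdeg c F) : Set N) := hf F
    rw [← he2] at this
    exact this
  choose f' hf' hef' using hex
  have hz : ∀ F, f F = 0 → f' F = 0 := by
    intro F h
    apply he1 (kdeg c F) (hf' F) (Submodule.zero_mem _)
    rw [hef', h, map_zero]
  have hf'0 : ∀ F, ¬ kgood c F → f' F = 0 := fun F hF => hz F (hf0 F hF)
  have hdf' : kd y f' = 0 := by
    ext F
    obtain ⟨h1, h2⟩ := key f' hf' hf'0 F
    apply he1 (kdeg c F) h2 (Submodule.zero_mem _)
    rw [← h1, map_zero]
    simp only [hef']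
    rw [hdf]; rfl
  obtain ⟨g', hg'⟩ := hM f' (fun F hF => hz F (hfs F hF)) hdf'
  let h : Finset (Fin n) → M := fun F =>
    if kgood c F then G.proj (rmap t (kdeg c F)) (g' F) else 0
  have hh : ∀ F, h F ∈ G.g (rmap t (kdeg c F)) := by
    intro F
    simp only [h]
    split_ifs
    · exact G.proj_mem _ _
    · exact Submodule.zero_mem _
  have hh0 : ∀ F, ¬ kgood c F → h F = 0 := fun F hF => by simp [h, hF]
  have hdh : ∀ F, kd y h F = f' F := by
    intro F
    by_cases hF : kgood c F
    · rw [← G.proj_of_mem (hf' F), ← hg', kd_apply, kd_apply, map_sum]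
      refine Finset.sum_congr rfl fun i hi => ?_
      rw [mul_smul, mul_smul]
      have := ksgn_smul_map (S := MvPolynomial (Fin n) K)
        (G.proj (rmap t (kdeg c F))).toAddMonoidHom i F (y i • g' (F.erase i))
      simp only [LinearMap.toAddMonoidHom_coe] at this
      rw [this]
      congr 1
      simp only [hy, h]
      by_cases hc : 1 ≤ c i
      · rw [if_pos ((kgood_erase hc).2 hF), hrm F i hi hc, X_pow_eq_mono, G.proj_mono_smul]
      · rw [if_neg (not_kgood_erase hc), X_pow_eq_mono, G.proj_mono_smul_zero, smul_zero]
        intro hle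
        have h1 := hle i
        rw [hrm0 F i hi hc] at h1
        have := ht i
        simp at h1
        omega
    · rw [hf'0 F hF, key0 h hh0 F hF]
  refine ⟨fun F => e (kdeg c F) (h F), ?_⟩
  ext F
  rw [(key h hh hh0 F).1, hdh, hef']

lemma acyc_rstar {t : Fin n → ℕ} (ht : ∀ i, 1 ≤ t i)
    {G : MultiGrading K n M} {H : MultiGrading K n N}
    (hN : IsRStar t G H) (d : ℕ)
    (hM : Acyc d (fun i => (X i ^ t i : MvPolynomial (Fin n) K)) M) :
    Acyc d (X : Fin n → MvPolynomial (Fin n) K) N := by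
  intro f hf hdf
  obtain ⟨T, hT⟩ := sum_kcomp H f
  have hex : ∀ c, ∃ g, kd (X : Fin n → MvPolynomial (Fin n) K) g = kcomp H c f := by
    intro c
    have h0 : ∀ F, ¬ kgood c F → kcomp H c f F = 0 := fun F hF => by simp [kcomp, hF]
    have hd : kd (X : Fin n → MvPolynomial (Fin n) K) (kcomp H c f) = 0 := by
      rw [kd_kcomp, hdf]
      ext F
      simp [kcomp]
    by_cases hc : ∃ i, 2 ≤ c i
    · obtain ⟨i, hi⟩ := hc
      exact acyc_case1 hN c i hi _ (kcomp_mem H c f) h0 hd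
    · push Not at hc
      exact acyc_case2 ht hN d hM c (fun i => by have := hc i; omega) _
        (fun F hF => by simp [kcomp, hf F hF]) (kcomp_mem H c f) h0 hd
  choose g hg using hex
  refine ⟨∑ c ∈ T, g c, ?_⟩
  rw [map_sum, Finset.sum_congr rfl fun c _ => hg c]
  exact hT.symm

end Grad

section Final
variable {M N : Type} [AddCommGroup M] [Module (MvPolynomial (Fin n) K) M]
    [Module K M] [IsScalarTower K (MvPolynomial (Fin n) K) M]
    [AddCommGroup N] [Module (MvPolynomial (Fin n) K) N] [Module K N]
    [IsScalarTower K (MvPolynomial (Fin n) K) N]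

lemma regular_length_le (H : MultiGrading K n N) [Nontrivial N]
    (rs : List (MvPolynomial (Fin n) K))
    (h1 : ∀ r ∈ rs, r ∈ Ideal.span (Set.range (X : Fin n → MvPolynomial (Fin n) K)))
    (h2 : RingTheory.Sequence.IsRegular N rs) : rs.length ≤ n := by
  by_contra hlt
  have hac := acyc_of_regular (X : Fin n → MvPolynomial (Fin n) K) rs N h2.toIsWeaklyRegular
    (fun r hr => Ideal.le_radical (h1 r hr))
  have hac' : Acyc (n + 1) (X : Fin n → MvPolynomial (Fin n) K) N := by
    intro f hf
    refine hac f fun F hF => hf F ?_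
    omega
  exact H.smul_top_ne (acyc_bound _ hac')

lemma span_X_le_radical (t : Fin n → ℕ) :
    Ideal.span (Set.range (X : Fin n → MvPolynomial (Fin n) K)) ≤
      (Ideal.span (Set.range fun i => (X i ^ t i : MvPolynomial (Fin n) K))).radical := by
  rw [Ideal.span_le]
  rintro _ ⟨i, rfl⟩
  exact Ideal.mem_radical_of_pow_mem (m := t i)
    (Ideal.le_radical (Ideal.subset_span (Set.mem_range_self i)))

lemma exists_regular_rstar (t : Fin n → ℕ) (ht : ∀ i, 1 ≤ t i)
    (G : MultiGrading K n M) [Module.Finite (MvPolynomial (Fin n) K) M]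
    (H : MultiGrading K n N) (hN : IsRStar t G H) [Nontrivial N]
    (rs : List (MvPolynomial (Fin n) K))
    (h1 : ∀ r ∈ rs, r ∈ Ideal.span (Set.range (X : Fin n → MvPolynomial (Fin n) K)))
    (h2 : RingTheory.Sequence.IsRegular M rs) :
    ∃ rs' : List (MvPolynomial (Fin n) K), rs'.length = rs.length ∧
    (∀ r ∈ rs', r ∈ Ideal.span (Set.range (X : Fin n → MvPolynomial (Fin n) K))) ∧
    RingTheory.Sequence.IsRegular N rs' := by
  have hfin : Module.Finite (MvPolynomial (Fin n) K) N := rstar_finite hN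
  have hac := acyc_of_regular (fun i => (X i ^ t i : MvPolynomial (Fin n) K)) rs M
    h2.toIsWeaklyRegular (fun r hr => span_X_le_radical t (h1 r hr))
  obtain ⟨rs', h3, h4, h5⟩ := regular_of_acyc _ _ N (acyc_rstar ht hN _ hac)
  refine ⟨rs', h3, h4, h5, ?_⟩
  intro h
  apply H.smul_top_ne
  refine le_antisymm ?_ le_top
  have hle : Ideal.ofList rs' ≤
      Ideal.span (Set.range (X : Fin n → MvPolynomial (Fin n) K)) := Ideal.span_le.2 h4
  exact h.le.trans (Submodule.smul_mono_left hle)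

end Final

/-- for positively `t`-determined `M` with `r^*M ≠ 0`,
`depth M ≤ depth r^*M`. -/
theorem depth_le_depth_rstar {M N : Type} [AddCommGroup M] [Module (MvPolynomial (Fin n) K) M]
    [Module K M] [IsScalarTower K (MvPolynomial (Fin n) K) M]
    [AddCommGroup N] [Module (MvPolynomial (Fin n) K) N] [Module K N]
    [IsScalarTower K (MvPolynomial (Fin n) K) N]
    (t : Fin n → ℕ) (ht : ∀ i, 1 ≤ t i)
    (G : MultiGrading K n M) [Module.Finite (MvPolynomial (Fin n) K) M]
    (hM : PosDetermined G t)
    (H : MultiGrading K n N) (hN : IsRStar t G H) (hN0 : Nontrivial N) :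
    mdepth K n M ≤ mdepth K n N := by
  unfold mdepth
  rcases Set.eq_empty_or_nonempty {k : ℕ | ∃ rs : List (MvPolynomial (Fin n) K), rs.length = k ∧
      (∀ r ∈ rs, r ∈ Ideal.span (Set.range (X : Fin n → MvPolynomial (Fin n) K))) ∧
      RingTheory.Sequence.IsRegular M rs} with hemp | hne
  · rw [hemp, csSup_empty]; exact Nat.zero_le _
  · refine csSup_le hne ?_
    rintro k ⟨rs, hk, h1, h2⟩
    obtain ⟨rs', h3, h4, h5⟩ := exists_regular_rstar t ht G H hN rs h1 h2
    refine le_csSup ⟨n, ?_⟩ ⟨rs', h3.trans hk, h4, h5⟩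
    rintro j ⟨qs, hj, h6, h7⟩
    rw [← hj]
    exact regular_length_le H qs h6 h7
end

section
/- Let I ⊆ J ⊆ S be monomial ideals with √I ≠ √J. If J/I is Cohen-Macaulay, then √J/√I is Cohen-Macaulay and dim J/I = dim √J/√I. -/
open MvPolynomial

variable {K : Type} [Field K] {n : ℕ}

/-- A monomial ideal: an ideal generated by monomials. -/
def IsMonomialIdeal (I : Ideal (MvPolynomial (Fin n) K)) : Prop :=
  ∃ A : Set (Fin n → ℕ), I = Ideal.span ((fun b => mono K b) '' A)

/-- The subquotient `J/I`. -/
abbrev idealSubquotient (I J : Ideal (MvPolynomial (Fin n) K)) : Type :=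
  ↥J ⧸ Submodule.comap (Submodule.subtype J) I

/-! ### Depth with respect to an ideal, via weakly regular sequences -/

section AbstractDepth

open RingTheory.Sequence
open scoped Pointwise

/-- There is a weakly regular sequence of length `k` in the ideal `m`. -/
def HasWeakSeq {R : Type} [CommRing R] (m : Ideal R) (k : ℕ) (M : Type) [AddCommGroup M]
    [Module R M] : Prop :=
  ∃ rs : List R, rs.length = k ∧ (∀ r ∈ rs, r ∈ m) ∧ IsWeaklyRegular M rs

lemma hasWeakSeq_zero {R : Type} [CommRing R] (m : Ideal R) (M : Type) [AddCommGroup M]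
    [Module R M] : HasWeakSeq m 0 M :=
  ⟨[], rfl, by simp, IsWeaklyRegular.nil R M⟩

lemma hasWeakSeq_succ {R : Type} [CommRing R] (m : Ideal R) (k : ℕ) (M : Type) [AddCommGroup M]
    [Module R M] :
    HasWeakSeq m (k + 1) M ↔ ∃ r ∈ m, IsSMulRegular M r ∧ HasWeakSeq m k (QuotSMulTop r M) := by
  constructor
  · rintro ⟨rs, hl, hm, hr⟩
    match rs, hl, hm, hr with
    | r :: rs, hl, hm, hr =>
      rw [isWeaklyRegular_cons_iff] at hr
      exact ⟨r, hm r (by simp), hr.1, rs, by simpa using hl,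
        fun x hx => hm x (by simp [hx]), hr.2⟩
  · rintro ⟨r, hrm, hr, rs, hl, hm, hrs⟩
    refine ⟨r :: rs, by simp [hl], ?_, (isWeaklyRegular_cons_iff M r rs).2 ⟨hr, hrs⟩⟩
    intro x hx
    rcases List.mem_cons.1 hx with rfl | hx
    · exact hrm
    · exact hm x hx

lemma HasWeakSeq.congr {R : Type} [CommRing R] {m : Ideal R} {k : ℕ} {M N : Type}
    [AddCommGroup M] [Module R M] [AddCommGroup N] [Module R N] (e : M ≃ₗ[R] N)
    (h : HasWeakSeq m k M) : HasWeakSeq m k N := by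
  obtain ⟨rs, hl, hm, hr⟩ := h
  exact ⟨rs, hl, hm, (e.isWeaklyRegular_congr rs).1 hr⟩

/-- Half of the swap. -/
def quotSwapHom {R : Type} [CommRing R] (r s : R) (M : Type) [AddCommGroup M] [Module R M] :
    QuotSMulTop s (QuotSMulTop r M) →ₗ[R] QuotSMulTop r (QuotSMulTop s M) :=
  Submodule.liftQ _ (Submodule.liftQ _
    ((Submodule.mkQ (r • (⊤ : Submodule R (QuotSMulTop s M)))).comp
      (Submodule.mkQ (s • (⊤ : Submodule R M))))
    (by
      intro x hx
      obtain ⟨y, -, rfl⟩ := (Submodule.mem_smul_pointwise_iff_exists _ _ _).1 hx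
      simp only [LinearMap.mem_ker, LinearMap.comp_apply, map_smul]
      rw [← map_smul, Submodule.mkQ_apply, Submodule.Quotient.mk_eq_zero]
      exact Submodule.smul_mem_pointwise_smul _ _ _ trivial))
    (by
      intro x hx
      obtain ⟨y, -, rfl⟩ := (Submodule.mem_smul_pointwise_iff_exists _ _ _).1 hx
      obtain ⟨y, rfl⟩ := Submodule.mkQ_surjective _ y
      simp only [LinearMap.mem_ker, map_smul]
      rw [Submodule.mkQ_apply, Submodule.liftQ_apply, LinearMap.comp_apply, ← map_smul,
        ← map_smul]
      have : (Submodule.mkQ (s • (⊤ : Submodule R M))) (s • y) = 0 := by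
        rw [Submodule.mkQ_apply, Submodule.Quotient.mk_eq_zero]
        exact Submodule.smul_mem_pointwise_smul _ _ _ trivial
      rw [this, map_zero])

/-- Quotients by two elements may be swapped. -/
def quotSwap {R : Type} [CommRing R] (r s : R) (M : Type) [AddCommGroup M] [Module R M] :
    QuotSMulTop s (QuotSMulTop r M) ≃ₗ[R] QuotSMulTop r (QuotSMulTop s M) :=
  LinearEquiv.ofLinearMap (quotSwapHom r s M) (quotSwapHom s r M)
    (by ext x; rfl) (by ext x; rfl)

lemma regular_swap {R : Type} [CommRing R] {r z : R} {M : Type} [AddCommGroup M] [Module R M]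
    (hr : IsSMulRegular M r) (hz : IsSMulRegular M z) (hzr : IsSMulRegular (QuotSMulTop r M) z) :
    IsSMulRegular (QuotSMulTop z M) r := by
  rw [isSMulRegular_quotient_iff_mem_of_smul_mem] at hzr ⊢
  intro x hx
  obtain ⟨y, -, hy⟩ := (Submodule.mem_smul_pointwise_iff_exists _ _ _).1 hx
  have hy' := hzr y (by rw [hy]; exact Submodule.smul_mem_pointwise_smul _ _ _ trivial)
  obtain ⟨w, -, rfl⟩ := (Submodule.mem_smul_pointwise_iff_exists _ _ _).1 hy'
  have : z • w = x := hr (by simpa only [smul_comm r z] using hy)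
  rw [← this]
  exact Submodule.smul_mem_pointwise_smul _ _ _ trivial

/-- Prime avoidance, along a ring map. -/
lemma exists_regular_map {R : Type} [CommRing R] [IsNoetherianRing R] (m : Ideal R)
    (φ : R →+* R) (hφ : ∀ p : Ideal R, p.IsPrime → (∀ x ∈ m, φ x ∈ p) → m ≤ p)
    (M : Type) [AddCommGroup M]
    [Module R M] [Module.Finite R M] (h : ∀ x : M, (∀ r ∈ m, r • x = 0) → x = 0) :
    ∃ z ∈ m, IsSMulRegular M (φ z) := by
  by_contra! hcon
  have hsub : (m : Set R) ⊆ ⋃ p ∈ associatedPrimes R M, (Ideal.comap φ p : Ideal R) := by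
    intro z hz
    have h1 : φ z ∈ ⋃ p ∈ associatedPrimes R M, (p : Set R) := by
      rw [biUnion_associatedPrimes_eq_compl_regular R M]
      exact hcon z hz
    simpa using h1
  obtain ⟨p, hp, hmp⟩ := (Ideal.subset_union_prime_finite (associatedPrimes.finite R M) ⊤ ⊤
    (fun p hp _ _ => by
      have := hp.1
      exact Ideal.comap_isPrime φ p)).1 hsub
  have hmp' : m ≤ p := hφ p hp.1 (fun x hx => hmp hx)
  obtain ⟨hpp, x, hx⟩ := (isAssociatedPrime_iff).1 hp
  have hx0 : x = 0 := h x (fun r hr => by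
    have := hmp' hr
    rw [hx] at this
    simpa [Submodule.mem_colon_singleton] using this)
  apply hpp.ne_top
  rw [hx, hx0]
  ext
  simp [Submodule.mem_colon_singleton]

lemma exists_regular_s15 {R : Type} [CommRing R] [IsNoetherianRing R] (m : Ideal R)
    (M : Type) [AddCommGroup M]
    [Module R M] [Module.Finite R M] (h : ∀ x : M, (∀ r ∈ m, r • x = 0) → x = 0) :
    ∃ z ∈ m, IsSMulRegular M z :=
  exists_regular_map m (RingHom.id R) (fun _ _ h => h) M h

lemma no_socle {R : Type} [CommRing R] {m : Ideal R} {k : ℕ} {M : Type} [AddCommGroup M]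
    [Module R M] (h : HasWeakSeq m (k + 1) M) (x : M) (hx : ∀ r ∈ m, r • x = 0) : x = 0 := by
  obtain ⟨r, hrm, hr, -⟩ := (hasWeakSeq_succ m k M).1 h
  exact hr.right_eq_zero_of_smul (hx r hrm)

/-- The socles of `M/rM` and `M/sM` vanish simultaneously. -/
lemma no_socle_swap {R : Type} [CommRing R] {m : Ideal R} {M : Type} [AddCommGroup M]
    [Module R M] {r s : R} (hr : IsSMulRegular M r) (hs : IsSMulRegular M s) (hrm : r ∈ m)
    (h : ∀ x : QuotSMulTop r M, (∀ a ∈ m, a • x = 0) → x = 0)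
    (x : QuotSMulTop s M) (hx : ∀ a ∈ m, a • x = 0) : x = 0 := by
  obtain ⟨u, rfl⟩ := Submodule.mkQ_surjective _ x
  have hx' : ∀ a ∈ m, ∃ y : M, s • y = a • u := by
    intro a ha
    have := hx a ha
    rw [← map_smul, Submodule.mkQ_apply, Submodule.Quotient.mk_eq_zero] at this
    obtain ⟨y, -, hy⟩ := (Submodule.mem_smul_pointwise_iff_exists _ _ _).1 this
    exact ⟨y, hy⟩
  obtain ⟨v, hv⟩ := hx' r hrm
  have hv0 := h (Submodule.mkQ _ v) (by
    intro a ha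
    obtain ⟨y, hy⟩ := hx' a ha
    rw [← map_smul, Submodule.mkQ_apply, Submodule.Quotient.mk_eq_zero]
    have : a • v = r • y := hs (by
      show s • a • v = s • r • y
      rw [smul_comm s a, hv, smul_comm s r, hy, smul_comm])
    rw [this]
    exact Submodule.smul_mem_pointwise_smul _ _ _ trivial)
  rw [Submodule.mkQ_apply, Submodule.Quotient.mk_eq_zero] at hv0 ⊢
  obtain ⟨w, -, rfl⟩ := (Submodule.mem_smul_pointwise_iff_exists _ _ _).1 hv0
  have : s • w = u := hr (by
    show r • s • w = r • u
    rw [← hv, smul_comm])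
  rw [← this]
  exact Submodule.smul_mem_pointwise_smul _ _ _ trivial

/-- Exchange: dividing out any regular element of `m` lowers the depth by at most one. -/
lemma HasWeakSeq.exchange {R : Type} [CommRing R] [IsNoetherianRing R] (m : Ideal R) (k : ℕ) :
    ∀ (M : Type) [AddCommGroup M] [Module R M] [Module.Finite R M] (s : R), s ∈ m →
      IsSMulRegular M s → HasWeakSeq m (k + 1) M → HasWeakSeq m k (QuotSMulTop s M) := by
  induction k with
  | zero => intro M _ _ _ s _ _ _; exact hasWeakSeq_zero m _
  | succ k ih =>
    intro M _ _ _ s hsm hs hM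
    have hsocM := no_socle hM
    obtain ⟨r, hrm, hr, hMr⟩ := (hasWeakSeq_succ m _ M).1 hM
    have hsocr := no_socle hMr
    have hsocs := no_socle_swap hr hs hrm hsocr
    obtain ⟨z, hzm, hz⟩ := exists_regular_s15 m (M × QuotSMulTop r M × QuotSMulTop s M) (by
      rintro ⟨x, y, w⟩ h
      simp only [Prod.smul_mk, Prod.mk_eq_zero] at h ⊢
      exact ⟨hsocM x fun a ha => (h a ha).1, hsocr y fun a ha => (h a ha).2.1,
        hsocs w fun a ha => (h a ha).2.2⟩)
    have hz1 : IsSMulRegular M z := by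
      intro x y hxy
      have := @hz (x, 0, 0) (y, 0, 0) (by simpa using hxy)
      simpa using this
    have hz2 : IsSMulRegular (QuotSMulTop r M) z := by
      intro x y hxy
      have := @hz (0, x, 0) (0, y, 0) (by simpa using hxy)
      simpa using this
    have hz3 : IsSMulRegular (QuotSMulTop s M) z := by
      intro x y hxy
      have := @hz (0, 0, x) (0, 0, y) (by simpa using hxy)
      simpa using this
    have h1 : HasWeakSeq m k (QuotSMulTop z (QuotSMulTop r M)) := ih _ z hzm hz2 hMr
    have h2 : HasWeakSeq m (k + 1) (QuotSMulTop z M) :=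
      (hasWeakSeq_succ m k _).2 ⟨r, hrm, regular_swap hr hz1 hz2, h1.congr (quotSwap r z M)⟩
    have h3 : HasWeakSeq m k (QuotSMulTop s (QuotSMulTop z M)) :=
      ih _ s hsm (regular_swap hs hz1 hz3) h2
    exact (hasWeakSeq_succ m k _).2 ⟨z, hzm, hz3, h3.congr (quotSwap z s M)⟩

/-- Depth does not drop on passing to a summand along a ring map `φ`. -/
lemma HasWeakSeq.summand {R : Type} [CommRing R] [IsNoetherianRing R] (m : Ideal R)
    (φ : R →+* R) (hφ : ∀ p : Ideal R, p.IsPrime → (∀ x ∈ m, φ x ∈ p) → m ≤ p)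
    (hφm : ∀ x ∈ m, φ x ∈ m) (k : ℕ) :
    ∀ (M N : Type) [AddCommGroup M] [Module R M] [Module.Finite R M] [AddCommGroup N] [Module R N]
      (i : N →+ M) (p : M →+ N), (∀ f x, i (f • x) = φ f • i x) →
      (∀ f x, p (φ f • x) = f • p x) → (∀ x, p (i x) = x) →
      HasWeakSeq m k M → HasWeakSeq m k N := by
  induction k with
  | zero => intro M N _ _ _ _ _ i p _ _ _ _; exact hasWeakSeq_zero m _
  | succ k ih =>
    intro M N _ _ _ _ _ i p hi hp hpi hM
    obtain ⟨z, hzm, hz⟩ := exists_regular_map m φ hφ M (no_socle hM)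
    have hM' := HasWeakSeq.exchange m k M (φ z) (hφm z hzm) hz hM
    have hzN : IsSMulRegular N z := by
      intro x y hxy
      have hxy' : z • x = z • y := hxy
      have h1 : i x = i y := hz (by
        show φ z • i x = φ z • i y
        rw [← hi, ← hi, hxy'])
      rw [← hpi x, ← hpi y, h1]
    refine (hasWeakSeq_succ m k N).2 ⟨z, hzm, hzN, ?_⟩
    let i' : QuotSMulTop z N →+ QuotSMulTop (φ z) M :=
      QuotientAddGroup.map (z • (⊤ : Submodule R N)).toAddSubgroup
        (φ z • (⊤ : Submodule R M)).toAddSubgroup i (by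
        intro x hx
        obtain ⟨y, -, rfl⟩ := (Submodule.mem_smul_pointwise_iff_exists _ _ _).1 hx
        show i (z • y) ∈ φ z • (⊤ : Submodule R M)
        rw [hi]
        exact Submodule.smul_mem_pointwise_smul _ _ _ trivial)
    let p' : QuotSMulTop (φ z) M →+ QuotSMulTop z N :=
      QuotientAddGroup.map (φ z • (⊤ : Submodule R M)).toAddSubgroup
        (z • (⊤ : Submodule R N)).toAddSubgroup p (by
        intro x hx
        obtain ⟨y, -, rfl⟩ := (Submodule.mem_smul_pointwise_iff_exists _ _ _).1 hx
        show p (φ z • y) ∈ z • (⊤ : Submodule R N)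
        rw [hp]
        exact Submodule.smul_mem_pointwise_smul _ _ _ trivial)
    refine ih (QuotSMulTop (φ z) M) (QuotSMulTop z N) i' p' ?_ ?_ ?_ hM'
    · intro f x
      obtain ⟨x, rfl⟩ := Submodule.mkQ_surjective _ x
      exact congrArg (Submodule.mkQ (φ z • (⊤ : Submodule R M))) (hi f x)
    · intro f x
      obtain ⟨x, rfl⟩ := Submodule.mkQ_surjective _ x
      exact congrArg (Submodule.mkQ (z • (⊤ : Submodule R N))) (hp f x)
    · intro x
      obtain ⟨x, rfl⟩ := Submodule.mkQ_surjective _ x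
      exact congrArg (Submodule.mkQ (z • (⊤ : Submodule R N))) (hpi x)

/-- A regular sequence is no longer than the dimension. -/
lemma length_le_supportDim {R : Type} [CommRing R] [IsNoetherianRing R] (rs : List R) :
    ∀ (M : Type) [AddCommGroup M] [Module R M] [Module.Finite R M],
      IsRegular M rs → (rs.length : WithBot ℕ∞) ≤ Module.supportDim R M := by
  induction rs with
  | nil =>
    intro M _ _ _ h
    have : Nontrivial M := IsRegular.nontrivial h
    have h2 := Module.supportDim_ne_bot_of_nontrivial R M
    obtain ⟨d, hd⟩ := WithBot.ne_bot_iff_exists.1 h2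
    rw [← hd]
    simp
  | cons r rs ih =>
    intro M _ _ _ h
    rw [isRegular_cons_iff] at h
    have h1 := ih _ h.2
    have h2 := Module.supportDim_quotSMulTop_succ_le_of_notMem_minimalPrimes (R := R) (M := M)
      (x := r) (fun _ => h.1.notMem_of_mem_minimalPrimes)
    refine le_trans ?_ h2
    simp only [List.length_cons, Nat.cast_add, Nat.cast_one]
    gcongr

lemma length_le_mdim {R : Type} [CommRing R] [IsNoetherianRing R] (rs : List R)
    (M : Type) [AddCommGroup M] [Module R M] [Module.Finite R M]
    (h : IsRegular M rs) : (rs.length : WithBot ℕ∞) ≤ mdim R M := by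
  have := length_le_supportDim rs M h
  rwa [Module.supportDim_eq_ringKrullDim_quotient_annihilator, ← Submodule.annihilator_top] at this

end AbstractDepth

/-! ### Monomial ideals -/

section MonomialIdeals

/-- Every monomial of an element of `I` lies in `I`. -/
def MonoClosed (I : Ideal (MvPolynomial (Fin n) K)) : Prop :=
  ∀ f ∈ I, ∀ a ∈ f.support, (monomial a (1 : K)) ∈ I

lemma mem_of_monomials {I : Ideal (MvPolynomial (Fin n) K)} {f : MvPolynomial (Fin n) K}
    (h : ∀ a ∈ f.support, (monomial a (1 : K)) ∈ I) : f ∈ I := by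
  rw [f.as_sum]
  refine Ideal.sum_mem _ fun a ha => ?_
  have := I.mul_mem_left (C (f.coeff a)) (h a ha)
  rwa [C_mul_monomial, mul_one] at this

lemma IsMonomialIdeal.monoClosed {I : Ideal (MvPolynomial (Fin n) K)} (hI : IsMonomialIdeal I) :
    MonoClosed I := by
  obtain ⟨A, rfl⟩ := hI
  have himg : ((fun b => mono K b) '' A) =
      (fun s => monomial s (1 : K)) '' (Finsupp.equivFunOnFinite.symm '' A) := by
    rw [Set.image_image]; rfl
  rw [himg]
  intro f hf a ha
  rw [mem_ideal_span_monomial_image] at hf ⊢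
  intro b hb
  have hb' : b = a := by
    have := support_monomial_subset hb
    simpa using this
  subst hb'
  exact hf b ha

lemma monomial_one_pow (a : Fin n →₀ ℕ) (k : ℕ) :
    (monomial a (1 : K)) ^ k = monomial (k • a) 1 := by
  rw [monomial_pow, one_pow]

lemma MonoClosed.radical {I : Ideal (MvPolynomial (Fin n) K)} (hI : MonoClosed I) :
    MonoClosed I.radical := by
  intro f hf a ha
  induction hk : f.support.card using Nat.strong_induction_on generalizing f with
  | _ k ih =>
    let m : MonomialOrder (Fin n) := MonomialOrder.lex
    have hf0 : f ≠ 0 := by rintro rfl; simp at ha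
    have hlead : (monomial (m.degree f) (1 : K)) ∈ I.radical := by
      obtain ⟨N, hN⟩ := hf
      refine ⟨N, ?_⟩
      rw [monomial_one_pow, ← m.degree_pow]
      exact hI _ hN _ (m.degree_mem_support (pow_ne_zero _ hf0))
    by_cases hae : a = m.degree f
    · rw [hae]; exact hlead
    · let g := f - monomial (m.degree f) (f.coeff (m.degree f))
      have hg : g ∈ I.radical := by
        refine Ideal.sub_mem _ hf ?_
        have := I.radical.mul_mem_left (C (f.coeff (m.degree f))) hlead
        rwa [C_mul_monomial, mul_one] at this
      have hcoeff : ∀ b, g.coeff b = if b = m.degree f then 0 else f.coeff b := by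
        intro b
        simp only [g, coeff_sub, coeff_monomial]
        by_cases hb : b = m.degree f
        · subst hb; simp
        · rw [if_neg (fun h => hb h.symm), if_neg hb, sub_zero]
      have hsub : g.support ⊂ f.support := by
        refine (Finset.ssubset_iff_of_subset ?_).2 ⟨m.degree f, m.degree_mem_support hf0, ?_⟩
        · intro b hb
          rw [mem_support_iff, hcoeff] at hb
          rw [mem_support_iff]
          intro h0
          simp [h0] at hb
        · rw [mem_support_iff, hcoeff]; simp
      refine ih _ (hk ▸ Finset.card_lt_card hsub) g hg ?_ rfl
      rw [mem_support_iff, hcoeff, if_neg hae]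
      exact mem_support_iff.1 ha

lemma nsmul_finsupp_injective {t : ℕ} (ht : 0 < t) :
    Function.Injective (fun a : Fin n →₀ ℕ => t • a) := by
  intro a b h
  ext i
  have := DFunLike.congr_fun h i
  simp only [Finsupp.smul_apply, smul_eq_mul] at this
  exact Nat.eq_of_mul_eq_mul_left ht this

/-- The contraction `x^(t a) ↦ x^a`, killing the other monomials. -/
noncomputable def contr (t : ℕ) (ht : 0 < t) :
    MvPolynomial (Fin n) K →+ MvPolynomial (Fin n) K where
  toFun f := AddMonoidAlgebra.comapDomain (fun a : Fin n →₀ ℕ => t • a)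
    (nsmul_finsupp_injective ht) f
  map_zero' := AddMonoidAlgebra.comapDomain_zero _ _
  map_add' := AddMonoidAlgebra.comapDomain_add _ _

lemma coeff_contr (t : ℕ) (ht : 0 < t) (f : MvPolynomial (Fin n) K) (a : Fin n →₀ ℕ) :
    (contr t ht f).coeff a = f.coeff (t • a) := rfl

lemma contr_expand_mul (t : ℕ) (ht : 0 < t) (f g : MvPolynomial (Fin n) K) :
    contr t ht (expand t f * g) = f * contr t ht g := by
  induction f using MvPolynomial.induction_on' with
  | monomial u c =>
    ext a
    rw [coeff_contr, expand_monomial, coeff_monomial_mul', coeff_monomial_mul', coeff_contr]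
    have h : t • u ≤ t • a ↔ u ≤ a := by
      simp only [Finsupp.le_def, Finsupp.smul_apply, smul_eq_mul]
      exact forall_congr' fun i => Nat.mul_le_mul_left_iff ht
    have h2 : t • a - t • u = t • (a - u) := by
      ext i; simp [Nat.mul_sub]
    simp only [h, h2]
  | add p q hp hq => simp only [map_add, add_mul, hp, hq]

lemma contr_expand (t : ℕ) (ht : 0 < t) (f : MvPolynomial (Fin n) K) :
    contr t ht (expand t f) = f := by
  ext a
  rw [coeff_contr, coeff_expand_smul _ ht.ne']

lemma contr_mem {I : Ideal (MvPolynomial (Fin n) K)} (hI : MonoClosed I) (t : ℕ) (ht : 0 < t)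
    {f : MvPolynomial (Fin n) K} (hf : f ∈ I) : contr t ht f ∈ I.radical := by
  refine mem_of_monomials fun a ha => ⟨t, ?_⟩
  rw [monomial_one_pow]
  exact hI f hf _ (by rw [mem_support_iff, coeff_contr] at ha; rwa [mem_support_iff])

lemma expand_mem {I : Ideal (MvPolynomial (Fin n) K)} (hI : MonoClosed I) (t : ℕ) (ht : 0 < t)
    (hpow : I.radical ^ t ≤ I)
    {f : MvPolynomial (Fin n) K} (hf : f ∈ I.radical) : expand t f ∈ I := by
  classical
  refine mem_of_monomials fun b hb => ?_
  rw [support_expand _ ht.ne'] at hb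
  obtain ⟨a, ha, rfl⟩ := Finset.mem_image.1 hb
  have := hpow (Ideal.pow_mem_pow (hI.radical f hf a ha) t)
  rwa [monomial_one_pow] at this

end MonomialIdeals

section MainProof

open RingTheory.Sequence

/-- An additive map on the ambient ring induces one on subquotients. -/
noncomputable def subqMap {I J I' J' : Ideal (MvPolynomial (Fin n) K)}
    (f : MvPolynomial (Fin n) K →+ MvPolynomial (Fin n) K)
    (hJ : ∀ x ∈ J, f x ∈ J') (hI : ∀ x ∈ I, f x ∈ I') :
    idealSubquotient I J →+ idealSubquotient I' J' :=
  QuotientAddGroup.map (Submodule.comap (Submodule.subtype J) I).toAddSubgroup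
    (Submodule.comap (Submodule.subtype J') I').toAddSubgroup
    ((f.comp J.toAddSubgroup.subtype).codRestrict J'.toAddSubgroup (fun x => hJ x.1 x.2))
    (fun x hx => hI x.1 hx)

lemma subqMap_mk {I J I' J' : Ideal (MvPolynomial (Fin n) K)}
    (f : MvPolynomial (Fin n) K →+ MvPolynomial (Fin n) K)
    (hJ : ∀ x ∈ J, f x ∈ J') (hI : ∀ x ∈ I, f x ∈ I') (x : J) :
    subqMap f hJ hI (Submodule.mkQ _ x) = Submodule.mkQ _ (⟨f x.1, hJ x.1 x.2⟩ : J') := rfl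

/-- The irrelevant ideal. -/
noncomputable abbrev irr (K : Type) [Field K] (n : ℕ) : Ideal (MvPolynomial (Fin n) K) :=
  Ideal.span (Set.range (X : Fin n → MvPolynomial (Fin n) K))

lemma constantCoeff_of_mem_irr {f : MvPolynomial (Fin n) K} (hf : f ∈ irr K n) :
    constantCoeff f = 0 := by
  have : irr K n ≤ RingHom.ker (constantCoeff : MvPolynomial (Fin n) K →+* K) := by
    rw [Ideal.span_le]
    rintro _ ⟨i, rfl⟩
    simp
  exact this hf

lemma hasWeakSeq_radical {I J : Ideal (MvPolynomial (Fin n) K)}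
    (hI : MonoClosed I) (hJ : MonoClosed J) {k : ℕ}
    (h : HasWeakSeq (irr K n) k (idealSubquotient I J)) :
    HasWeakSeq (irr K n) k (idealSubquotient I.radical J.radical) := by
  obtain ⟨a, ha⟩ := I.exists_radical_pow_le_of_fg (IsNoetherian.noetherian _)
  obtain ⟨b, hb⟩ := J.exists_radical_pow_le_of_fg (IsNoetherian.noetherian _)
  obtain ⟨t, ht, hta, htb⟩ : ∃ t : ℕ, 0 < t ∧ a ≤ t ∧ b ≤ t :=
    ⟨a + b + 1, by omega, by omega, by omega⟩
  replace ha := (Ideal.pow_le_pow_right hta).trans ha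
  replace hb := (Ideal.pow_le_pow_right htb).trans hb
  let φ : MvPolynomial (Fin n) K →+* MvPolynomial (Fin n) K := (expand t).toRingHom
  have hX : ∀ i : Fin n, φ (X i) = X i ^ t := fun i => expand_X t i
  have hφ : ∀ p : Ideal (MvPolynomial (Fin n) K), p.IsPrime →
      (∀ x ∈ irr K n, φ x ∈ p) → irr K n ≤ p := by
    intro p hp h
    rw [Ideal.span_le]
    rintro _ ⟨i, rfl⟩
    have := h (X i) (Ideal.subset_span ⟨i, rfl⟩)
    rw [hX] at this
    exact hp.mem_of_pow_mem t this
  have hφm : ∀ x ∈ irr K n, φ x ∈ irr K n := by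
    have : irr K n ≤ Ideal.comap φ (irr K n) := by
      rw [Ideal.span_le]
      rintro _ ⟨i, rfl⟩
      show φ (X i) ∈ irr K n
      rw [hX]
      exact Ideal.pow_mem_of_mem (irr K n) (Ideal.subset_span ⟨i, rfl⟩) t ht
    exact this
  refine HasWeakSeq.summand (irr K n) φ hφ hφm k (idealSubquotient I J)
    (idealSubquotient I.radical J.radical)
    (subqMap φ.toAddMonoidHom (fun x hx => expand_mem hJ t ht hb hx)
      (fun x hx => expand_mem hI t ht ha hx))
    (subqMap (contr t ht) (fun x hx => contr_mem hJ t ht hx) (fun x hx => contr_mem hI t ht hx))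
    ?_ ?_ ?_ h
  · intro f x
    obtain ⟨x, rfl⟩ := Submodule.mkQ_surjective _ x
    rw [← map_smul, subqMap_mk, subqMap_mk, ← map_smul]
    congr 1
    exact Subtype.ext (map_mul φ f x.1)
  · intro f x
    obtain ⟨x, rfl⟩ := Submodule.mkQ_surjective _ x
    rw [← map_smul, subqMap_mk, subqMap_mk, ← map_smul]
    congr 1
    exact Subtype.ext (contr_expand_mul t ht f x.1)
  · intro x
    obtain ⟨x, rfl⟩ := Submodule.mkQ_surjective _ x
    rw [subqMap_mk, subqMap_mk]
    congr 1
    exact Subtype.ext (contr_expand t ht x.1)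

lemma smul_top_ne {I J : Ideal (MvPolynomial (Fin n) K)}
    (hI : MonoClosed I) (hJ : MonoClosed J) (hIJ : I ≤ J) (hne : I ≠ J) :
    (⊤ : Submodule (MvPolynomial (Fin n) K) (idealSubquotient I J)) ≠ irr K n • ⊤ := by
  intro htop
  obtain ⟨r, hr, hr0⟩ := Submodule.exists_sub_one_mem_and_smul_eq_zero_of_fg_of_le_smul (irr K n)
    (⊤ : Submodule (MvPolynomial (Fin n) K) (idealSubquotient I J)) Module.Finite.fg_top htop.le
  have hrc : coeff 0 r = 1 := by
    have := constantCoeff_of_mem_irr hr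
    rw [map_sub, map_one, sub_eq_zero, constantCoeff_eq] at this
    exact this
  apply hne
  refine le_antisymm hIJ fun f hf => mem_of_monomials fun a ha => ?_
  have hr1 := hr0 (Submodule.mkQ _ (⟨monomial a 1, hJ f hf a ha⟩ : J)) trivial
  rw [← map_smul, Submodule.mkQ_apply, Submodule.Quotient.mk_eq_zero] at hr1
  have hr2 : r * monomial a (1 : K) ∈ I := hr1
  refine hI _ hr2 a ?_
  rw [mem_support_iff]
  have := coeff_mul_monomial 0 a (1 : K) r
  rw [zero_add, mul_one] at this
  rw [this, hrc]
  exact one_ne_zero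

lemma mdim_radical_le (I J : Ideal (MvPolynomial (Fin n) K)) :
    mdim (MvPolynomial (Fin n) K) (idealSubquotient I.radical J.radical) ≤
      mdim (MvPolynomial (Fin n) K) (idealSubquotient I J) := by
  have hle : (⊤ : Submodule (MvPolynomial (Fin n) K) (idealSubquotient I J)).annihilator ≤
      (⊤ : Submodule (MvPolynomial (Fin n) K)
        (idealSubquotient I.radical J.radical)).annihilator := by
    intro f hf
    rw [Submodule.mem_annihilator] at hf ⊢
    intro x _
    obtain ⟨⟨g, N, hg⟩, rfl⟩ := Submodule.mkQ_surjective _ x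
    have h1 := hf (Submodule.mkQ _ (⟨g ^ N, hg⟩ : J)) trivial
    rw [← map_smul, Submodule.mkQ_apply, Submodule.Quotient.mk_eq_zero] at h1 ⊢
    have h2 : f * g ^ N ∈ I := h1
    show f * g ∈ I.radical
    refine Ideal.mem_radical_of_pow_mem (m := N + 1) (Ideal.le_radical ?_)
    have h3 : (f * g) ^ (N + 1) = (f ^ N * g) * (f * g ^ N) := by ring
    rw [h3]
    exact I.mul_mem_left _ h2
  exact ringKrullDim_le_of_surjective (Ideal.Quotient.factor hle)
    (Ideal.Quotient.factor_surjective hle)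

end MainProof

/-- for monomial ideals `I ⊆ J` with `√I ≠ √J`, if `J/I` is Cohen-Macaulay then
`√J/√I` is Cohen-Macaulay and `dim J/I = dim √J/√I`. -/
theorem radical_quotient_CM (I J : Ideal (MvPolynomial (Fin n) K))
    (hI : IsMonomialIdeal I) (hJ : IsMonomialIdeal J) (hIJ : I ≤ J)
    (hne : I.radical ≠ J.radical)
    (hCM : IsCM K n (idealSubquotient I J)) :
    IsCM K n (idealSubquotient I.radical J.radical) ∧
      mdim (MvPolynomial (Fin n) K) (idealSubquotient I J) =
        mdim (MvPolynomial (Fin n) K) (idealSubquotient I.radical J.radical) := by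

  have hIc := hI.monoClosed
  have hJc := hJ.monoClosed
  have hle := mdim_radical_le I J
  set k := mdepth K n (idealSubquotient I J) with hk
  have hdim : mdim (MvPolynomial (Fin n) K) (idealSubquotient I J) = (k : WithBot ℕ∞) := hCM.symm
  -- the depth of `J/I` is attained
  have hseq : HasWeakSeq (irr K n) k (idealSubquotient I J) := by
    by_cases hemp : {k : ℕ | ∃ rs : List (MvPolynomial (Fin n) K), rs.length = k ∧
        (∀ r ∈ rs, r ∈ Ideal.span (Set.range (X : Fin n → MvPolynomial (Fin n) K))) ∧
        RingTheory.Sequence.IsRegular (idealSubquotient I J) rs}.Nonempty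
    · obtain ⟨rs, hl, hm, hr⟩ := Nat.sSup_mem hemp ⟨k, by
        rintro _ ⟨rs, rfl, -, hr⟩
        have := length_le_mdim rs _ hr
        rw [hdim] at this
        exact_mod_cast this⟩
      exact ⟨rs, hl, hm, hr.toIsWeaklyRegular⟩
    · have : k = 0 := by
        rw [hk, mdepth, Set.not_nonempty_iff_eq_empty.1 hemp]
        simp
      rw [this]
      exact hasWeakSeq_zero _ _
  obtain ⟨rs, hl, hm, hr⟩ := hasWeakSeq_radical hIc hJc hseq
  have hreg : RingTheory.Sequence.IsRegular (idealSubquotient I.radical J.radical) rs := by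
    refine ⟨hr, fun htop => ?_⟩
    refine smul_top_ne hIc.radical hJc.radical (Ideal.radical_mono hIJ) hne
      (le_antisymm ?_ le_top)
    conv_lhs => rw [htop]
    exact Submodule.smul_mono_left (Ideal.span_le.2 fun r hr => hm r hr)
  have hge := length_le_mdim rs _ hreg
  rw [hl] at hge
  have hdimN : mdim (MvPolynomial (Fin n) K) (idealSubquotient I.radical J.radical)
      = (k : WithBot ℕ∞) := le_antisymm (hle.trans hdim.le) hge
  refine ⟨?_, hdim.trans hdimN.symm⟩
  rw [IsCM, hdimN]
  have hdep : mdepth K n (idealSubquotient I.radical J.radical) = k := by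
    refine IsGreatest.csSup_eq ⟨⟨rs, hl, hm, hreg⟩, ?_⟩
    rintro _ ⟨rs', rfl, -, hr'⟩
    have := length_le_mdim rs' _ hr'
    rw [hdimN] at this
    exact_mod_cast this
  rw [hdep]
end
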